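/- arXiv:2005.05544 — 11 statements merged into one kernel-verified Lean document; each statement's English description precedes it below -/
import Mathlib

section
/- Let C be a braided monoidal category. (i) For invertible objects a and b of C, the composite a ⊗ b is invertible and χ_{a⊗b,X} = χ_{a,X} ∘ χ_{b,X} for every object X; thus χ defines a group homomorphism from the group of isomorphism classes of invertible objects of C to the group of monoidal natural automorphisms of the identity functor. (ii) For an invertible object a, χ_a is the identity natural transformation if and only if a is transparent; hence the kernel of χ is the group of isomorphism classes of transparent invertible objects. -/
open CategoryTheory MonoidalCategory

/-- Right tensoring by an object with a right inverse is faithful. -/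
theorem whiskerRight_injective_of_tensor_iso_unit {C : Type*} [Category C] [MonoidalCategory C]
    {a a' : C} (e : a ⊗ a' ≅ 𝟙_ C) {X Y : C} :
    Function.Injective fun f : X ⟶ Y => f ▷ a := by
  intro f g (h : f ▷ a = g ▷ a)
  rw [← MonoidalCategory.whiskerRight_iff, ← cancel_epi (X ◁ e.hom), whisker_exchange,
    whisker_exchange, whiskerRight_tensor, whiskerRight_tensor, h]

/-- The inverse of a tensor product is the tensor product of the inverses in reverse order. -/
def tensorTensorIsoUnit {C : Type*} [Category C] [MonoidalCategory C]
    {a a' b b' : C} (e : a ⊗ a' ≅ 𝟙_ C) (f : b ⊗ b' ≅ 𝟙_ C) :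
    (a ⊗ b) ⊗ (b' ⊗ a') ≅ 𝟙_ C :=
  α_ a b (b' ⊗ a') ≪≫ whiskerLeftIso a ((α_ b b' a').symm ≪≫ whiskerRightIso f a' ≪≫ λ_ a') ≪≫ e

/-- If the double braidings of `X` with `a` and with `b` are induced by endomorphisms of `X`,
then the double braiding with `a ⊗ b` is induced by their composite. -/
theorem comp_whiskerRight_tensor_eq_double_braiding {C : Type*} [Category C]
    [MonoidalCategory C] [BraidedCategory C] {a b X : C} {f g : X ⟶ X}
    (hf : f ▷ a = (β_ X a).hom ≫ (β_ a X).hom) (hg : g ▷ b = (β_ X b).hom ≫ (β_ b X).hom) :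
    (g ≫ f) ▷ (a ⊗ b) = (β_ X (a ⊗ b)).hom ≫ (β_ (a ⊗ b) X).hom := by
  have hmid : a ◁ (β_ X b).hom ≫ a ◁ (β_ b X).hom =
      (α_ a X b).inv ≫ (a ◁ g) ▷ b ≫ (α_ a X b).hom := by
    rw [← MonoidalCategory.whiskerLeft_comp, ← hg, whisker_assoc]
    simp
  have hout : (g ≫ f) ▷ a = (β_ X a).hom ≫ a ◁ g ≫ (β_ a X).hom := by
    rw [comp_whiskerRight, hf, BraidedCategory.braiding_naturality_left_assoc]
  rw [whiskerRight_tensor, hout, BraidedCategory.braiding_tensor_right_hom,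
    BraidedCategory.braiding_tensor_left_hom]
  simp only [Category.assoc, Iso.inv_hom_id_assoc, reassoc_of% hmid, Iso.hom_inv_id_assoc,
    comp_whiskerRight]

/-- Let `C` be a braided monoidal category, `a`, `b` invertible objects,
and `χa`, `χb`, `χab` the natural automorphisms of the identity determined by
`χ X ▷ a = c_{a,X} ∘ c_{X,a}` (and likewise for `b` and `a ⊗ b`).  Then
(i) `a ⊗ b` is invertible and `χ_{a⊗b,X} = χ_{a,X} ∘ χ_{b,X}` for every `X`
(so `χ` is a group homomorphism from invertible objects to monoidal natural
automorphisms of the identity), and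
(ii) `χa` is the identity if and only if `a` is transparent (so the kernel of `χ`
consists of the transparent invertible objects). -/
theorem statement2 {C : Type*} [Category C] [MonoidalCategory C] [BraidedCategory C]
    (a b : C)
    (ha : ∃ a' : C, Nonempty (a ⊗ a' ≅ 𝟙_ C) ∧ Nonempty (a' ⊗ a ≅ 𝟙_ C))
    (hb : ∃ b' : C, Nonempty (b ⊗ b' ≅ 𝟙_ C) ∧ Nonempty (b' ⊗ b ≅ 𝟙_ C))
    (χa χb χab : ∀ X : C, X ⟶ X)
    (hχa : ∀ X : C, χa X ▷ a = (β_ X a).hom ≫ (β_ a X).hom)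
    (hχb : ∀ X : C, χb X ▷ b = (β_ X b).hom ≫ (β_ b X).hom)
    (hχab : ∀ X : C, χab X ▷ (a ⊗ b) = (β_ X (a ⊗ b)).hom ≫ (β_ (a ⊗ b) X).hom) :
    (∃ c : C, Nonempty ((a ⊗ b) ⊗ c ≅ 𝟙_ C) ∧ Nonempty (c ⊗ (a ⊗ b) ≅ 𝟙_ C)) ∧
    (∀ X : C, χab X = χb X ≫ χa X) ∧
    ((∀ X : C, χa X = 𝟙 X) ↔ (∀ X : C, (β_ X a).hom ≫ (β_ a X).hom = 𝟙 (X ⊗ a))) := by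
  obtain ⟨a', ⟨ea⟩, ⟨ea'⟩⟩ := ha
  obtain ⟨b', ⟨eb⟩, ⟨eb'⟩⟩ := hb
  refine ⟨⟨b' ⊗ a', ⟨tensorTensorIsoUnit ea eb⟩, ⟨tensorTensorIsoUnit eb' ea'⟩⟩, fun X => ?_,
    forall_congr' fun X => ?_⟩
  · apply whiskerRight_injective_of_tensor_iso_unit (tensorTensorIsoUnit ea eb)
    exact (hχab X).trans (comp_whiskerRight_tensor_eq_double_braiding (hχa X) (hχb X)).symm
  · rw [← hχa X, ← id_whiskerRight]
    exact (whiskerRight_injective_of_tensor_iso_unit ea).eq_iff.symm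
end

section
/- Fix functions J, Λ, Ω : A × A × A → kˣ, and suppose t : A × A → kˣ satisfies the braided zesting equations relative to (J, Λ, Ω). Then a function t' : A × A → kˣ satisfies the braided zesting equations relative to (J, Λ, Ω) if and only if r(a,b) := t(a,b)·t'(a,b)⁻¹ is a bicharacter of A. In particular, the set of functions satisfying the braided zesting equations relative to fixed (J, Λ, Ω), if nonempty, forms a torsor over the group of bicharacters of A. -/
/-- The scalar form of the two braided zesting conditions for `t : A × A → kˣ`,
relative to fixed data `J`, `L` (the associative zesting `Λ`) and `Om` (the `Ω` data). -/
def SatisfiesBraidedZesting {A : Type*} [AddCommGroup A] {k : Type*} [Field k]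
    (J L Om : A → A → A → kˣ) (t : A → A → kˣ) : Prop :=
  (∀ a b c : A, J a b c * L a b c * t a (b + c) * L b c a = t a b * L b a c * t a c) ∧
  (∀ a b c : A, Om a b c * (L a b c)⁻¹ * t (a + b) c * (L c a b)⁻¹ =
      t b c * (L a c b)⁻¹ * t a c)

/-- A bicharacter of an abelian group `A` with values in `kˣ`. -/
def IsBicharacter {A : Type*} [AddCommGroup A] {k : Type*} [Field k]
    (r : A → A → kˣ) : Prop :=
  (∀ a b c : A, r a (b + c) = r a b * r a c) ∧
  (∀ a b c : A, r (a + b) c = r a c * r b c)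

/-- If `(u, p, q)` solves `x * u * y = p * v * q`, then `(u', p', q')` is another solution iff
the ratios satisfy the homogeneous equation. -/
theorem mul_mul_eq_mul_mul_iff_ratio {G : Type*} [CommGroup G] {x y v u p q : G}
    (h : x * u * y = p * v * q) (u' p' q' : G) :
    x * u' * y = p' * v * q' ↔ u * u'⁻¹ = p * p'⁻¹ * (q * q'⁻¹) := by
  rw [← div_eq_mul_inv, ← div_eq_mul_inv, ← div_eq_mul_inv, div_mul_div_comm,
    div_eq_div_iff_mul_eq_mul, ← mul_left_inj (x * u * y),
    ← mul_right_inj (a := x * v * y) (b := u * (p' * q'))]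
  nth_rewrite 1 [h]
  have hl : x * u' * y * (p * v * q) = x * v * y * (p * q * u') := by
    ac_rfl
  have hr : p' * v * q' * (x * u * y) = x * v * y * (u * (p' * q')) := by
    ac_rfl
  rw [hl, hr, eq_comm]

/-- Fix `J, Λ, Ω : A³ → kˣ` and suppose `t` satisfies the braided
zesting equations relative to `(J, Λ, Ω)`.  Then `t'` satisfies the braided zesting
equations relative to `(J, Λ, Ω)` iff `r(a,b) = t(a,b)·t'(a,b)⁻¹` is a bicharacter of
`A`; so the set of such solutions is a torsor over the group of bicharacters of `A`. -/
theorem statement3 {A : Type*} [AddCommGroup A] {k : Type*} [Field k]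
    (J L Om : A → A → A → kˣ) (t : A → A → kˣ)
    (ht : SatisfiesBraidedZesting J L Om t) (t' : A → A → kˣ) :
    SatisfiesBraidedZesting J L Om t' ↔
      IsBicharacter (fun a b => t a b * (t' a b)⁻¹) := by
  refine and_congr ?_ ?_
  · refine forall_congr' fun a => forall_congr' fun b => forall_congr' fun c => ?_
    have h : J a b c * L a b c * t a (b + c) * L b c a = t a b * L b a c * t a c := ht.1 a b c
    exact mul_mul_eq_mul_mul_iff_ratio h _ _ _
  · refine forall_congr' fun a => forall_congr' fun b => forall_congr' fun c => ?_
    rw [mul_mul_eq_mul_mul_iff_ratio (ht.2 a b c), mul_comm (t b c * _)]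
end

section
/- Fix s : A × A → ℂˣ and D : A → ℂˣ. (a) If f and f' are twist functions relative to s, then η := f·f'⁻¹ : A → ℂˣ is a group homomorphism; conversely, if f is a twist function relative to s and η : A → ℂˣ is a group homomorphism, then f·η is a twist function relative to s. Hence the set of twist functions relative to s, if nonempty, is a torsor over Hom(A, ℂˣ). (b) If f and f' are ribbon functions relative to (s, D), then η := f·f'⁻¹ is a group homomorphism satisfying η(2a) = 1 for all a ∈ A; conversely, multiplying a ribbon function by a group homomorphism η with η(2a) = 1 for all a yields a ribbon function. Hence the set of ribbon functions relative to (s, D), if nonempty, is a torsor over the group of characters of A that are trivial on 2A. -/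
/-- The scalar form of the twist zesting condition: `f 0 = 1` and
`f a · f b = f (a+b) · s a b`. -/
def IsTwistFun {A : Type*} [AddCommGroup A] (s : A → A → ℂˣ) (f : A → ℂˣ) : Prop :=
  f 0 = 1 ∧ ∀ a b : A, f a * f b = f (a + b) * s a b

/-- The scalar form of the ribbon condition: a twist function with
`f a = f (−a) · D a`. -/
def IsRibbonFun {A : Type*} [AddCommGroup A] (s : A → A → ℂˣ) (D : A → ℂˣ)
    (f : A → ℂˣ) : Prop :=
  IsTwistFun s f ∧ ∀ a : A, f a = f (-a) * D a

theorem IsTwistFun.div_map_add {A : Type*} [AddCommGroup A] {s : A → A → ℂˣ} {f f' : A → ℂˣ}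
    (hf : IsTwistFun s f) (hf' : IsTwistFun s f') (a b : A) :
    f (a + b) * (f' (a + b))⁻¹ = (f a * (f' a)⁻¹) * (f b * (f' b)⁻¹) := by
  rw [mul_mul_mul_comm, ← mul_inv, hf.2, hf'.2, mul_inv, mul_mul_mul_comm, mul_inv_cancel (s a b),
    mul_one]

theorem IsTwistFun.mul_hom {A : Type*} [AddCommGroup A] {s : A → A → ℂˣ} {f η : A → ℂˣ}
    (hf : IsTwistFun s f) (hη : ∀ a b : A, η (a + b) = η a * η b) :
    IsTwistFun s (fun a => f a * η a) := by
  have h0 : η 0 = 1 := by simpa using hη 0 0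
  refine ⟨by simp [hf.1, h0], fun a b => ?_⟩
  rw [mul_mul_mul_comm, hf.2, ← hη, mul_right_comm]

theorem IsRibbonFun.div_map_add_self {A : Type*} [AddCommGroup A] {s : A → A → ℂˣ} {D : A → ℂˣ}
    {f f' : A → ℂˣ} (hf : IsRibbonFun s D f) (hf' : IsRibbonFun s D f') (a : A) :
    f (a + a) * (f' (a + a))⁻¹ = 1 := by
  have hneg : f a * (f' a)⁻¹ = f (-a) * (f' (-a))⁻¹ := by
    rw [hf.2 a, hf'.2 a, mul_inv, mul_mul_mul_comm, mul_inv_cancel, mul_one]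
  rw [hf.1.div_map_add hf'.1]
  nth_rewrite 2 [hneg]
  rw [← hf.1.div_map_add hf'.1, add_neg_cancel, hf.1.1, hf'.1.1, inv_one, mul_one]

theorem IsRibbonFun.mul_hom {A : Type*} [AddCommGroup A] {s : A → A → ℂˣ} {D : A → ℂˣ}
    {f η : A → ℂˣ} (hf : IsRibbonFun s D f) (hη : ∀ a b : A, η (a + b) = η a * η b)
    (hη2 : ∀ a : A, η (a + a) = 1) : IsRibbonFun s D (fun a => f a * η a) := by
  refine ⟨hf.1.mul_hom hη, fun a => ?_⟩
  have hneg : η (-a) = η a := by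
    rw [← mul_one (η (-a)), ← hη2 a, ← hη, neg_add_cancel_left]
  simp only [hneg]
  rw [hf.2 a, mul_right_comm]

/-- (a) The ratio of two twist functions relative to `s` is a group
homomorphism `A → ℂˣ`, and multiplying a twist function by a group homomorphism gives a
twist function: the twist functions form a torsor over `Hom(A, ℂˣ)`.
(b) The ratio of two ribbon functions relative to `(s, D)` is a group homomorphism killing
`2A`, and multiplying a ribbon function by such a homomorphism gives a ribbon function:
the ribbon functions form a torsor over the characters of `A` trivial on `2A`. -/
theorem statement4 {A : Type*} [AddCommGroup A] (s : A → A → ℂˣ) (D : A → ℂˣ) :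
    (∀ f f' : A → ℂˣ, IsTwistFun s f → IsTwistFun s f' →
      ∀ a b : A, f (a + b) * (f' (a + b))⁻¹ = (f a * (f' a)⁻¹) * (f b * (f' b)⁻¹)) ∧
    (∀ f η : A → ℂˣ, IsTwistFun s f → (∀ a b : A, η (a + b) = η a * η b) →
      IsTwistFun s (fun a => f a * η a)) ∧
    (∀ f f' : A → ℂˣ, IsRibbonFun s D f → IsRibbonFun s D f' →
      (∀ a b : A, f (a + b) * (f' (a + b))⁻¹ = (f a * (f' a)⁻¹) * (f b * (f' b)⁻¹)) ∧
      (∀ a : A, f (a + a) * (f' (a + a))⁻¹ = 1)) ∧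
    (∀ f η : A → ℂˣ, IsRibbonFun s D f → (∀ a b : A, η (a + b) = η a * η b) →
      (∀ a : A, η (a + a) = 1) → IsRibbonFun s D (fun a => f a * η a)) := by
  exact ⟨fun _ _ hf hf' => hf.div_map_add hf', fun _ _ hf hη => hf.mul_hom hη,
    fun _ _ hf hf' => ⟨hf.1.div_map_add hf'.1, hf.div_map_add_self hf'⟩,
    fun _ _ hf hη hη2 => hf.mul_hom hη hη2⟩
end

section
/- For every α ∈ C^n(A,N) and every 1 ≤ p ≤ n, one has (δα)_p = δ_h(α_{p−1}) + (−1)^p · δ_v(α_p) as elements of D^{p,n+1−p}(A,N), where by convention α_0 = 0 and α_n = 0. -/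
/-- The `i`-th inner face of the bar complex: merge the `i`-th and `(i+1)`-st entries. -/
def barFace {A : Type*} [Add A] {n : ℕ} (i : Fin n) (g : Fin (n + 1) → A) :
    Fin n → A := fun j =>
  if (j : ℕ) < (i : ℕ) then g j.castSucc
  else if (j : ℕ) = (i : ℕ) then g j.castSucc + g j.succ
  else g j.succ

/-- The standard inhomogeneous bar differential (trivial action):
`(δf)(g₁,…,g_{n+1}) = f(g₂,…,g_{n+1}) + Σᵢ (−1)ⁱ f(g₁,…,gᵢ+g_{i+1},…,g_{n+1})
  + (−1)^{n+1} f(g₁,…,g_n)`. -/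
def barDiff {A N : Type*} [Add A] [AddCommGroup N] {n : ℕ}
    (f : (Fin n → A) → N) : (Fin (n + 1) → A) → N := fun g =>
  f (fun j => g j.succ)
    + ∑ i : Fin n, ((-1 : ℤ) ^ ((i : ℕ) + 1)) • f (barFace i g)
    + ((-1 : ℤ) ^ (n + 1)) • f (fun j => g j.castSucc)

/-- The horizontal differential `δ_h : D^{p,q} → D^{p+1,q}`: the bar differential applied
to the first block of variables. -/
def hDiff {A N : Type*} [Add A] [AddCommGroup N] {p q : ℕ}
    (f : (Fin p → A) × (Fin q → A) → N) : (Fin (p + 1) → A) × (Fin q → A) → N :=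
  fun x => barDiff (fun x' => f (x', x.2)) x.1

/-- The vertical differential `δ_v : D^{p,q} → D^{p,q+1}`: the bar differential applied
to the second block of variables. -/
def vDiff {A N : Type*} [Add A] [AddCommGroup N] {p q : ℕ}
    (f : (Fin p → A) × (Fin q → A) → N) : (Fin p → A) × (Fin (q + 1) → A) → N :=
  fun x => barDiff (fun y' => f (x.1, y')) x.2

/-- `(p,q)`-shuffles: permutations `π` of `{0,…,p+q−1}` which are increasing on the first
`p` positions and on the last `q` positions. -/
def IsShuffle (p q : ℕ) (π : Equiv.Perm (Fin (p + q))) : Prop :=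
  ∀ i j : Fin (p + q), i < j → ((j : ℕ) < p ∨ p ≤ (i : ℕ)) → π i < π j

instance (p q : ℕ) : DecidablePred (IsShuffle p q) := fun π =>
  inferInstanceAs (Decidable
    (∀ i j : Fin (p + q), i < j → ((j : ℕ) < p ∨ p ≤ (i : ℕ)) → π i < π j))

/-- The `p`-th shuffle `α_p ∈ D^{p,q}(A,N)` of an `n`-cochain `α` (where `n = p + q`):
`α_p(a₁,…,a_p | a_{p+1},…,a_n) = Σ_{π ∈ Shuff(p,q)} sgn(π) · α(a_{π(1)},…,a_{π(n)})`,
with the convention that it is `0` when `p = 0` or `q = 0` (since `D^{p,q} = 0` there). -/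
def shuffleCochain {A N : Type*} [AddCommGroup N] (p q : ℕ) {n : ℕ}
    (h : p + q = n) (α : (Fin n → A) → N) :
    (Fin p → A) × (Fin q → A) → N :=
  if p = 0 ∨ q = 0 then 0
  else fun x =>
    ∑ π ∈ Finset.univ.filter (IsShuffle p q),
      ((Equiv.Perm.sign π : ℤˣ) : ℤ) •
        α (fun i : Fin n => Fin.append x.1 x.2 (π⁻¹ (Fin.cast h.symm i)))

/-- The bar differential of a cochain family `F`, given as a function on lists. -/
def listBarDiff {A N : Type*} [Add A] [AddCommGroup N] : (List A → N) → List A → N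
  | _, [] => 0
  | _, [_] => 0
  | F, x :: y :: l =>
    F (y :: l) - F ((x + y) :: l) + F (x :: l) - listBarDiff (fun m => F (x :: m)) (y :: l)

/-- The signed sum of `F` over all shuffles of two lists. -/
def listShuffle {A N : Type*} [AddCommGroup N] : (List A → N) → List A → List A → N
  | F, [], b => F b
  | F, a, [] => F a
  | F, x :: a, y :: b =>
    listShuffle (fun m => F (x :: m)) a (y :: b)
      + ((-1 : ℤ) ^ (a.length + 1)) • listShuffle (fun m => F (y :: m)) (x :: a) b
termination_by _ a b => a.length + b.length

/-- The difference between merging `x` into the head of a list and prepending it, under `F`;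
this is the part of `listBarDiff F (x :: l)` not visible to `F l` and the differential of
`F (x :: ·)`. -/
def listMerge {A N : Type*} [Add A] [AddCommGroup N] (x : A) (F : List A → N) : List A → N
  | [] => F []
  | y :: l => F ((x + y) :: l) - F (x :: l)

section ListIdentity

variable {A N : Type*} [AddCommGroup N]

@[simp] lemma listShuffle_nil_left (F : List A → N) (b : List A) :
    listShuffle F [] b = F b := by
  rw [listShuffle]

@[simp] lemma listShuffle_nil_right (F : List A → N) (a : List A) :
    listShuffle F a [] = F a := by
  cases a <;> simp [listShuffle]

lemma listShuffle_cons_cons (F : List A → N) (x y : A) (a b : List A) :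
    listShuffle F (x :: a) (y :: b) =
      listShuffle (fun m => F (x :: m)) a (y :: b)
      + ((-1 : ℤ) ^ (a.length + 1)) • listShuffle (fun m => F (y :: m)) (x :: a) b := by
  rw [listShuffle]

lemma listShuffle_sub (F G : List A → N) (a b : List A) :
    listShuffle (fun l => F l - G l) a b = listShuffle F a b - listShuffle G a b := by
  induction a generalizing F G b with
  | nil => simp
  | cons x a iha =>
    induction b generalizing F G with
    | nil => simp
    | cons y b ihb =>
      simp only [listShuffle_cons_cons, iha, ihb, smul_sub]
      abel

lemma listBarDiff_cons [Add A] (F : List A → N) (x : A) (l : List A) :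
    listBarDiff F (x :: l) =
      F l - listMerge x F l - listBarDiff (fun m => F (x :: m)) l := by
  cases l with
  | nil => simp [listBarDiff, listMerge]
  | cons y l => simp only [listBarDiff, listMerge]; abel

lemma listBarDiff_add_smul [Add A] (F G : List A → N) (c : ℤ) (l : List A) :
    listBarDiff (fun m => F m + c • G m) l = listBarDiff F l + c • listBarDiff G l := by
  induction l generalizing F G with
  | nil => simp [listBarDiff]
  | cons x l ih =>
    rw [listBarDiff_cons, listBarDiff_cons, listBarDiff_cons, ih]
    cases l <;> simp only [listMerge] <;> module

lemma listBarDiff_congr [Add A] {F G : List A → N} {l : List A}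
    (h : ∀ m, m.length + 1 = l.length → F m = G m) : listBarDiff F l = listBarDiff G l := by
  induction l generalizing F G with
  | nil => rfl
  | cons x l ih =>
    cases l with
    | nil => rfl
    | cons y l =>
      simp only [listBarDiff]
      rw [ih fun m hm => h _ (by simpa using hm), h _ (by simp), h _ (by simp), h _ (by simp)]

lemma listShuffle_listMerge_left [Add A] (F : List A → N) (x y : A) (a b : List A) :
    listShuffle (listMerge x F) a (y :: b) =
      listMerge x (fun m => listShuffle F m (y :: b)) a
      + ((-1 : ℤ) ^ a.length) • (listShuffle (fun m => F ((x + y) :: m)) a b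
        - listShuffle (fun m => F (x :: m)) a b
        - listMerge x (fun m => listShuffle (fun k => F (y :: k)) m b) a) := by
  cases a with
  | nil => simp [listMerge]
  | cons z a =>
    simp only [listShuffle_cons_cons, listMerge, listShuffle_sub, List.length_cons]
    module

lemma listShuffle_listMerge_right [Add A] (F : List A → N) (x y : A) (a b : List A) :
    listShuffle (listMerge y F) (x :: a) b =
      listShuffle (fun m => F ((y + x) :: m)) a b - listShuffle (fun m => F (y :: m)) a b
      - listMerge y (fun m => listShuffle (fun k => F (x :: k)) a m) b
      + listMerge y (fun m => listShuffle F (x :: a) m) b := by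
  cases b with
  | nil => simp [listMerge]
  | cons z b =>
    simp only [listShuffle_cons_cons, listMerge, listShuffle_sub]
    module

/-- The shuffle identity for cochain families on lists. -/
theorem listShuffle_listBarDiff [AddCommGroup A] (F : List A → N) (a b : List A) :
    listShuffle (listBarDiff F) a b =
      listBarDiff (fun m => listShuffle F m b) a
      + ((-1 : ℤ) ^ a.length) • listBarDiff (fun m => listShuffle F a m) b := by
  induction a generalizing F b with
  | nil => simp [listBarDiff]
  | cons x a iha =>
    induction b generalizing F with
    | nil => simp [listBarDiff]
    | cons y b ihb =>
      have hx : listBarDiff (fun m => listShuffle F (x :: m) (y :: b)) a =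
          listBarDiff (fun m => listShuffle (fun k => F (x :: k)) m (y :: b)) a
          + ((-1 : ℤ) ^ a.length) •
            listBarDiff (fun m => listShuffle (fun k => F (y :: k)) (x :: m) b) a := by
        rw [← listBarDiff_add_smul]
        refine listBarDiff_congr fun m hm => ?_
        rw [listShuffle_cons_cons, hm]
      have hy : listBarDiff (fun m => listShuffle F (x :: a) (y :: m)) b =
          listBarDiff (fun m => listShuffle (fun k => F (x :: k)) a (y :: m)) b
          + ((-1 : ℤ) ^ (a.length + 1)) •
            listBarDiff (fun m => listShuffle (fun k => F (y :: k)) (x :: a) m) b := by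
        rw [← listBarDiff_add_smul]
        simp only [listShuffle_cons_cons]
      rw [listShuffle_cons_cons]
      simp only [listBarDiff_cons, listShuffle_sub, iha, ihb, hx, hy,
        listShuffle_listMerge_left, listShuffle_listMerge_right, add_comm y x, List.length_cons]
      rcases neg_one_pow_eq_or ℤ a.length with h | h <;> simp only [pow_succ, h] <;> module

end ListIdentity

/-- The permutation of `Fin (n + 1)` that sends `i` to `0` and is given by `e` on the
complement of `i`. -/
def permOfZeroPreimage {n : ℕ} (i : Fin (n + 1)) (e : Equiv.Perm (Fin n)) :
    Equiv.Perm (Fin (n + 1)) :=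
  Equiv.Perm.decomposeFin.symm (0, e) * i.cycleRange

section Perm

variable {n : ℕ} (i : Fin (n + 1)) (e : Equiv.Perm (Fin n))

@[simp] lemma permOfZeroPreimage_self : permOfZeroPreimage i e i = 0 := by
  simp [permOfZeroPreimage]

@[simp] lemma permOfZeroPreimage_succAbove (j : Fin n) :
    permOfZeroPreimage i e (i.succAbove j) = (e j).succ := by
  simp [permOfZeroPreimage, ← Fin.cycleRange_symm_succ]

@[simp] lemma permOfZeroPreimage_inv_zero : (permOfZeroPreimage i e)⁻¹ 0 = i := by
  rw [Equiv.Perm.inv_eq_iff_eq, permOfZeroPreimage_self]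

@[simp] lemma permOfZeroPreimage_inv_succ (j : Fin n) :
    (permOfZeroPreimage i e)⁻¹ j.succ = i.succAbove (e⁻¹ j) := by
  rw [Equiv.Perm.inv_eq_iff_eq, permOfZeroPreimage_succAbove]
  simp

lemma sign_permOfZeroPreimage :
    Equiv.Perm.sign (permOfZeroPreimage i e) = (-1) ^ (i : ℕ) * Equiv.Perm.sign e := by
  simp [permOfZeroPreimage, mul_comm]

lemma permOfZeroPreimage_bijective :
    Function.Bijective fun x : Fin (n + 1) × Equiv.Perm (Fin n) =>
      permOfZeroPreimage x.1 x.2 := by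
  rw [Fintype.bijective_iff_injective_and_card]
  refine ⟨?_, by simp [Fintype.card_perm, Nat.factorial_succ]⟩
  rintro ⟨i, e⟩ ⟨j, f⟩ h
  obtain rfl : i = j := by
    simpa using congrArg (fun π : Equiv.Perm (Fin (n + 1)) => π⁻¹ 0) h
  refine Prod.ext rfl (Equiv.ext fun k => ?_)
  simpa using congrArg (fun π : Equiv.Perm (Fin (n + 1)) => π (i.succAbove k)) h

end Perm

/-- A permutation of `Fin n` that is increasing on the positions before `p` and on the
remaining ones. -/
def IsShuffleAt (p : ℕ) {n : ℕ} (π : Equiv.Perm (Fin n)) : Prop :=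
  ∀ i j : Fin n, i < j → ((j : ℕ) < p ∨ p ≤ (i : ℕ)) → π i < π j

instance (p : ℕ) {n : ℕ} : DecidablePred (IsShuffleAt p (n := n)) := fun π =>
  inferInstanceAs (Decidable
    (∀ i j : Fin n, i < j → ((j : ℕ) < p ∨ p ≤ (i : ℕ)) → π i < π j))

lemma isShuffleAt_permOfZeroPreimage_zero {p n : ℕ} (e : Equiv.Perm (Fin n)) :
    IsShuffleAt (p + 1) (permOfZeroPreimage 0 e) ↔ IsShuffleAt p e := by
  have h (j : Fin n) : permOfZeroPreimage 0 e j.succ = (e j).succ := by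
    simpa using permOfZeroPreimage_succAbove 0 e j
  simp [IsShuffleAt, Fin.forall_fin_succ, h]

lemma isShuffleAt_permOfZeroPreimage {p n : ℕ} (k : Fin (n + 1)) (hk : (k : ℕ) = p)
    (e : Equiv.Perm (Fin n)) :
    IsShuffleAt p (permOfZeroPreimage k e) ↔ IsShuffleAt p e := by
  have hlt (j : Fin n) : ((k.succAbove j : Fin (n + 1)) : ℕ) < p ↔ (j : ℕ) < p := by
    simp only [Fin.succAbove, Fin.lt_def]
    grind
  have hle (j : Fin n) : p ≤ ((k.succAbove j : Fin (n + 1)) : ℕ) ↔ p ≤ (j : ℕ) := by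
    rw [← not_lt, hlt, not_lt]
  simp only [IsShuffleAt, Fin.forall_iff_succAbove k, permOfZeroPreimage_self,
    permOfZeroPreimage_succAbove, Fin.succAbove_lt_succAbove_iff, hlt, hle,
    Fin.succ_lt_succ_iff, lt_self_iff_false, Fin.succ_pos, Fin.not_lt_zero, hk]
  refine ⟨fun h i j => (h.2 i).2 j, fun h => ⟨⟨by simp, by simp⟩, fun i => ⟨?_, h i⟩⟩⟩
  intro hik hi
  have := hlt i
  rw [Fin.lt_def] at hik
  simp only [false_or] at hi
  omega

lemma not_isShuffleAt_permOfZeroPreimage {p n : ℕ} {i k : Fin (n + 1)} (hk : (k : ℕ) = p + 1)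
    (h0 : i ≠ 0) (hik : i ≠ k) (e : Equiv.Perm (Fin n)) :
    ¬ IsShuffleAt (p + 1) (permOfZeroPreimage i e) := by
  intro h
  rcases lt_or_gt_of_ne hik with hlt | hlt
  · simpa using h 0 i (Fin.pos_of_ne_zero h0) (Or.inl (hk ▸ hlt))
  · simpa using h k i hlt (Or.inr hk.ge)

lemma isShuffleAt_iff_eq_one {p n : ℕ} (hp : p = 0 ∨ n ≤ p) (π : Equiv.Perm (Fin n)) :
    IsShuffleAt p π ↔ π = 1 := by
  refine ⟨fun h => ?_, ?_⟩
  · have hπ : StrictMono π := fun i j hij => h i j hij (by omega)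
    exact Equiv.coe_fn_injective hπ.eq_id
  · rintro rfl i j hij -
    exact hij

/-- The signed sum of `f` over the shuffles of the first `p` entries of a tuple with the
remaining ones. -/
def shuffleSum {A N : Type*} [AddCommGroup N] (p : ℕ) {n : ℕ} (f : (Fin n → A) → N)
    (w : Fin n → A) : N :=
  ∑ π : Equiv.Perm (Fin n) with IsShuffleAt p π,
    ((Equiv.Perm.sign π : ℤˣ) : ℤ) • f fun i => w (π⁻¹ i)

section ShuffleSum

variable {A N : Type*} [AddCommGroup N] {n : ℕ}

lemma shuffleSum_of_trivial {p : ℕ} (hp : p = 0 ∨ n ≤ p) (f : (Fin n → A) → N)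
    (w : Fin n → A) : shuffleSum p f w = f w := by
  simp [shuffleSum, isShuffleAt_iff_eq_one hp, Finset.filter_eq', ← Equiv.Perm.inv_def]

lemma shuffleSum_succ {p : ℕ} (k : Fin (n + 1)) (hk : (k : ℕ) = p + 1)
    (f : (Fin (n + 1) → A) → N) (w : Fin (n + 1) → A) :
    shuffleSum (p + 1) f w =
      shuffleSum p (fun g => f (Fin.cons (w 0) g)) (fun i => w i.succ)
      + ((-1 : ℤ) ^ (p + 1)) •
        shuffleSum (p + 1) (fun g => f (Fin.cons (w k) g)) (fun i => w (k.succAbove i)) := by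
  have hw (i : Fin (n + 1)) (e : Equiv.Perm (Fin n)) :
      (fun j => w ((permOfZeroPreimage i e)⁻¹ j)) =
        Fin.cons (w i) fun j => w (i.succAbove (e⁻¹ j)) := by
    funext j
    cases j using Fin.cases <;> simp
  have hk0 : (0 : Fin (n + 1)) ≠ k := by
    rintro rfl
    simp at hk
  simp only [shuffleSum, Finset.sum_filter]
  rw [← Function.Bijective.sum_comp permOfZeroPreimage_bijective, Fintype.sum_prod_type,
    Fintype.sum_eq_add 0 k hk0]
  · simp only [hw, sign_permOfZeroPreimage, isShuffleAt_permOfZeroPreimage_zero,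
      isShuffleAt_permOfZeroPreimage k hk, hk, Finset.smul_sum]
    congr 1
    · simp
    · refine Finset.sum_congr rfl fun e _ => ?_
      simp [mul_smul, smul_ite]
  · rintro i ⟨h0, hik⟩
    exact Finset.sum_eq_zero fun e _ =>
      if_neg (not_isShuffleAt_permOfZeroPreimage hk h0 hik e)

lemma ofFn_succAbove (w : Fin (n + 1) → A) (k : Fin (n + 1)) :
    List.ofFn (fun i => w (k.succAbove i)) = (List.ofFn w).eraseIdx k := by
  refine List.ext_getElem (by simp [List.length_eraseIdx, k.is_le]) fun i h₁ h₂ => ?_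
  simp only [List.getElem_ofFn, List.getElem_eraseIdx, Fin.succAbove, Fin.lt_def]
  split_ifs <;> simp_all

lemma shuffleSum_ofFn (F : List A → N) (a b : List A) (w : Fin n → A)
    (hw : List.ofFn w = a ++ b) :
    shuffleSum a.length (fun g => F (List.ofFn g)) w = listShuffle F a b := by
  induction n generalizing F a b with
  | zero =>
    rw [shuffleSum_of_trivial (by simp), hw]
    obtain ⟨rfl, rfl⟩ : a = [] ∧ b = [] := by simpa using hw.symm
    simp
  | succ n ih =>
    have hlen : n + 1 = a.length + b.length := by simpa using congrArg List.length hw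
    match a, b with
    | [], b => rw [shuffleSum_of_trivial (by simp), hw]; simp
    | x :: a, [] =>
      rw [shuffleSum_of_trivial (Or.inr (by simpa using hlen.le)), hw]; simp
    | x :: a, y :: b =>
      simp only [List.length_cons] at hlen ⊢
      let k : Fin (n + 1) := ⟨a.length + 1, by omega⟩
      have h0 : w 0 = x := by
        simpa using congrArg List.head? hw
      have hk : w k = y := by
        have h := congrArg (fun l => l[a.length + 1]?) hw
        simp only [List.getElem?_ofFn] at h
        simpa [k, show a.length < n by omega] using h
      rw [shuffleSum_succ k rfl, listShuffle_cons_cons, h0, hk]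
      simp only [List.ofFn_cons]
      rw [ih (fun m => F (x :: m)) a (y :: b) _ (by simpa using congrArg List.tail hw),
        ← ih (fun m => F (y :: m)) (x :: a) b _ ?_, List.length_cons]
      rw [ofFn_succAbove, hw, List.eraseIdx_append_of_length_le (by simp [k])]
      simp [k]

end ShuffleSum

section Comparison

variable {A N : Type*} [AddCommGroup N]

lemma barDiff_zero [Add A] {n : ℕ} : barDiff (fun _ : Fin n → A => (0 : N)) = 0 := by
  funext g
  simp [barDiff]

lemma barDiff_ofFn [Add A] (F : List A → N) {n : ℕ} (g : Fin (n + 1) → A) :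
    barDiff (fun w : Fin n → A => F (List.ofFn w)) g = listBarDiff F (List.ofFn g) := by
  induction n generalizing F with
  | zero => simp [barDiff, listBarDiff]
  | succ n ih =>
    have h0 : List.ofFn (barFace 0 g) = (g 0 + g 1) :: List.ofFn (fun i => g i.succ.succ) := by
      simp [List.ofFn_succ, barFace]
    have hs (i : Fin n) :
        List.ofFn (barFace i.succ g) = g 0 :: List.ofFn (barFace i fun j => g j.succ) := by
      rw [List.ofFn_succ]
      simp [barFace, funext_iff]
    have ih' := ih (fun m => F (g 0 :: m)) (fun i => g i.succ)
    rw [List.ofFn_succ, List.ofFn_succ, listBarDiff, ← List.ofFn_succ (f := fun i => g i.succ),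
      ← ih']
    simp only [barDiff, Fin.sum_univ_succ, h0, hs]
    simp only [List.ofFn_succ, pow_succ, Fin.val_succ, Fin.val_zero]
    simp [← sub_eq_add_neg]
    abel

lemma shuffleCochain_apply {p q n : ℕ} (h : p + q = n) (hp : p ≠ 0) (hq : q ≠ 0)
    (F : List A → N) (a : Fin p → A) (b : Fin q → A) :
    shuffleCochain p q h (fun w : Fin n → A => F (List.ofFn w)) (a, b) =
      listShuffle F (List.ofFn a) (List.ofFn b) := by
  subst h
  rw [shuffleCochain, if_neg (by tauto),
    ← shuffleSum_ofFn F (List.ofFn a) (List.ofFn b) (Fin.append a b) (List.ofFn_fin_append a b),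
    List.length_ofFn]
  rfl

lemma hDiff_shuffleCochain [Add A] {p q n : ℕ} (h : p + q = n) (hq : q ≠ 0)
    (F : List A → N) (a : Fin (p + 1) → A) (b : Fin q → A) :
    hDiff (shuffleCochain p q h fun w : Fin n → A => F (List.ofFn w)) (a, b) =
      listBarDiff (fun l => listShuffle F l (List.ofFn b)) (List.ofFn a) := by
  rcases eq_or_ne p 0 with rfl | hp
  · have : shuffleCochain 0 q h (fun w : Fin n → A => F (List.ofFn w)) = 0 := by
      simp [shuffleCochain]
    simpa [hDiff, this, listBarDiff] using congrFun (barDiff_zero (A := A) (N := N)) a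
  · simp only [hDiff, shuffleCochain_apply h hp hq]
    exact barDiff_ofFn (fun l => listShuffle F l (List.ofFn b)) a

lemma vDiff_shuffleCochain [Add A] {p q n : ℕ} (h : p + q = n) (hp : p ≠ 0)
    (F : List A → N) (a : Fin p → A) (b : Fin (q + 1) → A) :
    vDiff (shuffleCochain p q h fun w : Fin n → A => F (List.ofFn w)) (a, b) =
      listBarDiff (fun l => listShuffle F (List.ofFn a) l) (List.ofFn b) := by
  rcases eq_or_ne q 0 with rfl | hq
  · have : shuffleCochain p 0 h (fun w : Fin n → A => F (List.ofFn w)) = 0 := by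
      simp [shuffleCochain]
    simpa [vDiff, this, listBarDiff] using congrFun (barDiff_zero (A := A) (N := N)) b
  · simp only [vDiff, shuffleCochain_apply h hp hq]
    exact barDiff_ofFn (fun l => listShuffle F (List.ofFn a) l) b

lemma exists_eq_comp_ofFn {n : ℕ} (α : (Fin n → A) → N) :
    ∃ F : List A → N, α = fun w => F (List.ofFn w) :=
  ⟨Function.extend List.ofFn α 0,
    funext fun w => (List.ofFn_injective.extend_apply α 0 w).symm⟩

end Comparison

/-- Hochschild–Serre shuffle identity.  For every `α ∈ Cⁿ(A,N)` and
every `1 ≤ p ≤ n` (here `p = p' + 1`, `n = p' + 1 + q`):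
`(δα)_p = δ_h(α_{p−1}) + (−1)^p · δ_v(α_p)` in `D^{p,n+1−p}(A,N)`,
with the conventions `α_0 = 0` and `α_n = 0`. -/
theorem statement5 {A N : Type*} [AddCommGroup A] [AddCommGroup N] (p' q : ℕ)
    (α : (Fin (p' + 1 + q) → A) → N) :
    shuffleCochain (p' + 1) (q + 1) (by omega) (barDiff α)
      = hDiff (shuffleCochain p' (q + 1) (by omega) α)
        + ((-1 : ℤ) ^ (p' + 1)) • vDiff (shuffleCochain (p' + 1) q (by omega) α) := by
  obtain ⟨F, rfl⟩ := exists_eq_comp_ofFn α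
  funext ⟨a, b⟩
  rw [Pi.add_apply, Pi.smul_apply, hDiff_shuffleCochain _ q.succ_ne_zero,
    vDiff_shuffleCochain _ p'.succ_ne_zero, funext (barDiff_ofFn F),
    shuffleCochain_apply _ p'.succ_ne_zero q.succ_ne_zero, listShuffle_listBarDiff,
    List.length_ofFn]
end

section
/- For every a ∈ A, the 2-cochain (b,c) ↦ μ₁(a|b,c) is a ℂˣ-valued 2-cocycle on A; that is, μ₁(a|c,d) · μ₁(a|b,c+d) = μ₁(a|b+c,d) · μ₁(a|b,c) for all a,b,c,d ∈ A. -/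
/-- The first shuffle of a 3-cochain `μ`: `μ₁(a|b,c) = μ(a,b,c)·μ(b,a,c)⁻¹·μ(b,c,a)`. -/
def mu1 {A : Type*} (μ : A → A → A → ℂˣ) (a b c : A) : ℂˣ :=
  μ a b c * (μ b a c)⁻¹ * μ b c a

/-- Let `λ̄ : A × A → M` be a symmetric 2-cocycle, `B : M × M → ℂˣ` a
function, and `μ : A³ → ℂˣ` a 3-cochain whose coboundary is the cup product of `λ̄` with
itself via `B`.  Then for every `a ∈ A`, the 2-cochain `(b,c) ↦ μ₁(a|b,c)` is a
`ℂˣ`-valued 2-cocycle on `A`. -/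
theorem statement6 {A M : Type*} [AddCommGroup A] [CommGroup M]
    (lam : A → A → M)
    (hsymm : ∀ a b : A, lam a b = lam b a)
    (hcoc : ∀ a b c : A, lam b c * lam a (b + c) = lam a b * lam (a + b) c)
    (B : M → M → ℂˣ) (μ : A → A → A → ℂˣ)
    (hμ : ∀ a b c d : A,
      μ b c d * μ a (b + c) d * μ a b c * (μ (a + b) c d)⁻¹ * (μ a b (c + d))⁻¹
        = B (lam a b) (lam c d)) :
    ∀ a b c d : A,
      mu1 μ a c d * mu1 μ a b (c + d) = mu1 μ a (b + c) d * mu1 μ a b c := by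
  intro a b c d
  have h : B (lam a b) (lam c d) * (B (lam b a) (lam c d))⁻¹ * B (lam b c) (lam a d) *
      (B (lam b c) (lam d a))⁻¹ = 1 := by
    rw [hsymm b a, hsymm d a, mul_inv_cancel, one_mul, mul_inv_cancel]
  rw [← inv_mul_eq_one, ← h, ← hμ a b c d, ← hμ b a c d, ← hμ b c a d, ← hμ b c d a,
    add_comm b a, add_comm c a, add_comm d a]
  unfold mu1
  apply Additive.ofMul.injective
  simp only [ofMul_mul, ofMul_inv]
  abel
end

section
/- Define O₁(λ̄,ν,j̃)(a|b,c) := j̃_a(λ̄(b,c)) · ν(a,b+c) · ν(a,b)⁻¹ · ν(a,c)⁻¹ · μ₁(a|b,c). Then: (i) for every a ∈ A, the 2-cochain (b,c) ↦ O₁(λ̄,ν,j̃)(a|b,c) is a ℂˣ-valued 2-cocycle on A, i.e. O₁(a|c,d)·O₁(a|b,c+d) = O₁(a|b+c,d)·O₁(a|b,c) for all b,c,d; (ii) if ν' : A × A → ℂˣ is another function and j̃' : A → Hom(M,ℂˣ) is another family such that both j̃ and j̃' satisfy j̃_a(y)·j̃_b(y) = j̃_{a+b}(y)·B(λ̄(a,b),y)⁻¹·B(y,λ̄(a,b))⁻¹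 for all a,b ∈ A and y ∈ M, then for each a ∈ A the 2-cocycles O₁(λ̄,ν,j̃)(a|−,−) and O₁(λ̄,ν',j̃')(a|−,−) are cohomologous: there exists g_a : A → ℂˣ with O₁(λ̄,ν,j̃)(a|b,c) = O₁(λ̄,ν',j̃')(a|b,c) · g_a(b)·g_a(c)·g_a(b+c)⁻¹ for all b,c ∈ A. -/
/-- The first obstruction cochain
`O₁(λ̄,ν,j̃)(a|b,c) = j̃_a(λ̄(b,c)) · ν(a,b+c) · ν(a,b)⁻¹ · ν(a,c)⁻¹ · μ₁(a|b,c)`. -/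
def obsOne {A M : Type*} [AddCommGroup A] [CommGroup M]
    (lam : A → A → M) (μ : A → A → A → ℂˣ) (ν : A → A → ℂˣ)
    (jt : A → M →* ℂˣ) (a b c : A) : ℂˣ :=
  jt a (lam b c) * ν a (b + c) * (ν a b)⁻¹ * (ν a c)⁻¹ * mu1 μ a b c

/-- The extension of `A` by `D` determined by a 2-cochain `f`, as a set of pairs. -/
@[ext]
structure TwistedProd {A D : Type*} (f : A → A → D) where
  fst : A
  snd : D

namespace TwistedProd

variable {A D : Type*} [AddCommGroup A] [AddCommGroup D] {f : A → A → D}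

instance : Add (TwistedProd f) := ⟨fun p q ↦ ⟨p.fst + q.fst, p.snd + q.snd + f p.fst q.fst⟩⟩

instance : Zero (TwistedProd f) := ⟨⟨0, -f 0 0⟩⟩

instance : Neg (TwistedProd f) := ⟨fun p ↦ ⟨-p.fst, -p.snd - f (-p.fst) p.fst - f 0 0⟩⟩

theorem cocycle_zero_left (hcoc : ∀ a b c, f b c + f a (b + c) = f a b + f (a + b) c) (a : A) :
    f 0 a = f 0 0 := by
  have h := hcoc 0 0 a
  simp only [zero_add] at h
  exact add_right_cancel h

/-- For a symmetric 2-cocycle `f`, the operation `(a, x) + (b, y) = (a + b, x + y + f a b)` is an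
abelian group structure. -/
abbrev addCommGroup (hsymm : ∀ a b, f a b = f b a)
    (hcoc : ∀ a b c, f b c + f a (b + c) = f a b + f (a + b) c) :
    AddCommGroup (TwistedProd f) where
  add_assoc p q r := by
    refine TwistedProd.ext (add_assoc _ _ _) ?_
    change p.snd + q.snd + f p.fst q.fst + r.snd + f (p.fst + q.fst) r.fst
      = p.snd + (q.snd + r.snd + f q.fst r.fst) + f p.fst (q.fst + r.fst)
    linear_combination (norm := module) -hcoc p.fst q.fst r.fst
  zero_add p := by
    refine TwistedProd.ext (zero_add _) ?_
    change -f 0 0 + p.snd + f 0 p.fst = p.snd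
    rw [cocycle_zero_left hcoc p.fst]
    abel
  add_zero p := by
    refine TwistedProd.ext (add_zero _) ?_
    change p.snd + -f 0 0 + f p.fst 0 = p.snd
    rw [hsymm p.fst 0, cocycle_zero_left hcoc p.fst]
    abel
  neg_add_cancel p := by
    refine TwistedProd.ext (neg_add_cancel _) ?_
    change -p.snd - f (-p.fst) p.fst - f 0 0 + p.snd + f (-p.fst) p.fst = -f 0 0
    abel
  add_comm p q := by
    refine TwistedProd.ext (add_comm _ _) ?_
    change p.snd + q.snd + f p.fst q.fst = q.snd + p.snd + f q.fst p.fst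
    rw [hsymm p.fst, add_comm p.snd]
  nsmul := nsmulRec
  zsmul := zsmulRec

end TwistedProd

/-- A symmetric 2-cocycle with values in a divisible abelian group is a coboundary. -/
theorem exists_eq_coboundary_of_symm_cocycle {A D : Type*} [AddCommGroup A] [AddCommGroup D]
    [DivisibleBy D ℤ] (f : A → A → D) (hsymm : ∀ a b, f a b = f b a)
    (hcoc : ∀ a b c, f b c + f a (b + c) = f a b + f (a + b) c) :
    ∃ g : A → D, ∀ b c, f b c = g b + g c - g (b + c) := by
  let := TwistedProd.addCommGroup hsymm hcoc
  have add_def (p q : TwistedProd f) :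
      p + q = ⟨p.fst + q.fst, p.snd + q.snd + f p.fst q.fst⟩ := rfl
  let i : D →+ TwistedProd f := AddMonoidHom.mk' (fun x ↦ ⟨0, x - f 0 0⟩) fun x y ↦ by
    rw [add_def]
    refine TwistedProd.ext (add_zero _).symm ?_
    change x + y - f 0 0 = x - f 0 0 + (y - f 0 0) + f 0 0
    abel
  have hi : Function.Injective i := fun x y h ↦ sub_left_injective (congrArg TwistedProd.snd h)
  obtain ⟨r, hr⟩ :=
    (Module.Baer.of_divisible D).extension_property_addMonoidHom i hi (AddMonoidHom.id D)
  refine ⟨fun a ↦ r ⟨a, 0⟩, fun b c ↦ ?_⟩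
  have key : (⟨b, 0⟩ + ⟨c, 0⟩ : TwistedProd f) = i (f b c) + ⟨b + c, 0⟩ := by
    rw [add_def, add_def]
    refine TwistedProd.ext (zero_add _).symm ?_
    change 0 + 0 + f b c = f b c - f 0 0 + 0 + f 0 (b + c)
    rw [TwistedProd.cocycle_zero_left hcoc (b + c)]
    abel
  rw [← map_add, key, map_add, add_sub_cancel_right]
  exact (DFunLike.congr_fun hr (f b c)).symm

/-- The unit group of an algebraically closed field is divisible. -/
noncomputable abbrev divisibleByIntAdditiveUnits (K : Type*) [Field K] [IsAlgClosed K] :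
    DivisibleBy (Additive Kˣ) ℤ :=
  haveI : DivisibleBy (Additive Kˣ) ℕ := divisibleByOfSMulRightSurj _ _ fun {n} hn x ↦ by
    obtain ⟨z, hz⟩ := IsAlgClosed.exists_pow_nat_eq (x.toMul : K) (Nat.pos_of_ne_zero hn)
    have hz0 : z ≠ 0 := by
      rintro rfl
      exact x.toMul.ne_zero (by rw [← hz, zero_pow hn])
    exact ⟨Additive.ofMul (Units.mk0 z hz0), congrArg Additive.ofMul (Units.ext hz)⟩
  AddGroup.divisibleByIntOfDivisibleByNat _

/-- The shuffle `μ₁(a|-,-)` is a 2-cocycle when the coboundary of `μ` is the cup product of a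
symmetric cochain with itself. -/
theorem mu1_cocycle {A M : Type*} [AddCommGroup A] {lam : A → A → M}
    (hsymm : ∀ a b : A, lam a b = lam b a) {B : M → M → ℂˣ} {μ : A → A → A → ℂˣ}
    (hμ : ∀ a b c d : A,
      μ b c d * μ a (b + c) d * μ a b c * (μ (a + b) c d)⁻¹ * (μ a b (c + d))⁻¹
        = B (lam a b) (lam c d)) (a b c d : A) :
    mu1 μ a c d * mu1 μ a b (c + d) = mu1 μ a (b + c) d * mu1 μ a b c := by
  have h₁ := congrArg Additive.ofMul (hμ a b c d)
  have h₂ := congrArg Additive.ofMul (hμ b a c d)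
  have h₃ := congrArg Additive.ofMul (hμ b c a d)
  have h₄ := congrArg Additive.ofMul (hμ b c d a)
  rw [hsymm b a, add_comm b a] at h₂
  rw [add_comm c a] at h₃
  rw [hsymm d a, add_comm d a] at h₄
  apply Additive.ofMul.injective
  simp only [mu1, ofMul_mul, ofMul_inv] at h₁ h₂ h₃ h₄ ⊢
  linear_combination (norm := module) h₂ - h₁ - h₃ + h₄

/-- (i) For every `a ∈ A`, `(b,c) ↦ O₁(λ̄,ν,j̃)(a|b,c)` is a
`ℂˣ`-valued 2-cocycle on `A`.  (ii) If `ν'`, `j̃'` are other choices with both `j̃` and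
`j̃'` compatible with `λ̄` via `B`, then for each `a` the 2-cocycles
`O₁(λ̄,ν,j̃)(a|−,−)` and `O₁(λ̄,ν',j̃')(a|−,−)` are cohomologous. -/
theorem statement7 {A M : Type*} [AddCommGroup A] [CommGroup M]
    (lam : A → A → M)
    (hsymm : ∀ a b : A, lam a b = lam b a)
    (hcoc : ∀ a b c : A, lam b c * lam a (b + c) = lam a b * lam (a + b) c)
    (B : M → M → ℂˣ) (μ : A → A → A → ℂˣ)
    (hμ : ∀ a b c d : A,
      μ b c d * μ a (b + c) d * μ a b c * (μ (a + b) c d)⁻¹ * (μ a b (c + d))⁻¹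
        = B (lam a b) (lam c d))
    (ν : A → A → ℂˣ) (jt : A → M →* ℂˣ) :
    (∀ a b c d : A,
      obsOne lam μ ν jt a c d * obsOne lam μ ν jt a b (c + d)
        = obsOne lam μ ν jt a (b + c) d * obsOne lam μ ν jt a b c) ∧
    (∀ (ν' : A → A → ℂˣ) (jt' : A → M →* ℂˣ),
      (∀ (a b : A) (y : M),
        jt a y * jt b y = jt (a + b) y * (B (lam a b) y)⁻¹ * (B y (lam a b))⁻¹) →
      (∀ (a b : A) (y : M),
        jt' a y * jt' b y = jt' (a + b) y * (B (lam a b) y)⁻¹ * (B y (lam a b))⁻¹) →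
      ∀ a : A, ∃ g : A → ℂˣ, ∀ b c : A,
        obsOne lam μ ν jt a b c
          = obsOne lam μ ν' jt' a b c * (g b * g c * (g (b + c))⁻¹)) := by
  refine ⟨fun a b c d ↦ ?_, fun ν' jt' _ _ a ↦ ?_⟩
  · have h₁ := congrArg Additive.ofMul (mu1_cocycle hsymm hμ a b c d)
    have h₂ := congrArg (fun y ↦ Additive.ofMul (jt a y)) (hcoc b c d)
    apply Additive.ofMul.injective
    simp only [obsOne, map_mul, ofMul_mul, ofMul_inv, add_assoc b c d] at h₁ h₂ ⊢
    linear_combination (norm := module) h₁ + h₂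
  · let := divisibleByIntAdditiveUnits ℂ
    obtain ⟨g, hg⟩ := exists_eq_coboundary_of_symm_cocycle
      (fun b c ↦ Additive.ofMul ((jt a / jt' a) (lam b c)))
      (fun b c ↦ by rw [hsymm])
      (fun b c d ↦ by rw [← ofMul_mul, ← ofMul_mul, ← map_mul, ← map_mul, hcoc])
    refine ⟨fun b ↦ (g b).toMul * ν' a b * (ν a b)⁻¹, fun b c ↦ ?_⟩
    have h := hg b c
    apply Additive.ofMul.injective
    simp only [obsOne, MonoidHom.div_apply, ofMul_mul, ofMul_inv, ofMul_div, ofMul_toMul] at h ⊢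
    linear_combination (norm := module) h
end

section
/- For every d ∈ A, the 2-cochain (a,b) ↦ μ₂(a,b|d) is a ℂˣ-valued 2-cocycle on A; that is, μ₂(b,c|d) · μ₂(a,b+c|d) = μ₂(a+b,c|d) · μ₂(a,b|d) for all a,b,c,d ∈ A. -/
/-- The second shuffle of a 3-cochain `μ`: `μ₂(a,b|c) = μ(a,b,c)·μ(a,c,b)⁻¹·μ(c,a,b)`. -/
def mu2 {A : Type*} (μ : A → A → A → ℂˣ) (a b c : A) : ℂˣ :=
  μ a b c * (μ a c b)⁻¹ * μ c a b

/-- Let `λ̄ : A × A → M` be a symmetric 2-cocycle, `B : M × M → ℂˣ` a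
function, and `μ : A³ → ℂˣ` a 3-cochain whose coboundary is the cup product of `λ̄` with
itself via `B`.  Then for every `d ∈ A`, the 2-cochain `(a,b) ↦ μ₂(a,b|d)` is a
`ℂˣ`-valued 2-cocycle on `A`. -/
theorem statement9 {A M : Type*} [AddCommGroup A] [CommGroup M]
    (lam : A → A → M)
    (hsymm : ∀ a b : A, lam a b = lam b a)
    (hcoc : ∀ a b c : A, lam b c * lam a (b + c) = lam a b * lam (a + b) c)
    (B : M → M → ℂˣ) (μ : A → A → A → ℂˣ)
    (hμ : ∀ a b c d : A,
      μ b c d * μ a (b + c) d * μ a b c * (μ (a + b) c d)⁻¹ * (μ a b (c + d))⁻¹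
        = B (lam a b) (lam c d)) :
    ∀ a b c d : A,
      mu2 μ b c d * mu2 μ a (b + c) d = mu2 μ (a + b) c d * mu2 μ a b d := by
  intro a b c d
  have h₁ := hμ a b c d
  have h₂ := hμ a b d c
  have h₃ := hμ a d b c
  have h₄ := hμ d a b c
  rw [hsymm d c, ← h₁] at h₂
  rw [hsymm d a, ← h₃] at h₄
  rw [add_comm d c, add_comm b d] at h₂
  rw [add_comm d a] at h₄
  have e₂ := congrArg Additive.ofMul h₂
  have e₄ := congrArg Additive.ofMul h₄
  apply Additive.ofMul.injective
  simp only [mu2, ofMul_mul, ofMul_inv] at e₂ e₄ ⊢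
  linear_combination (norm := abel) -e₂ - e₄
end

section
/- For all a,b,c,d ∈ A, the Shuff(2,2) identity holds: [μ₁(b|c,d) · μ₁(a|c,d) · μ₁(a+b|c,d)⁻¹] · [μ₂(a,b|c) · μ₂(a,b|d) · μ₂(a,b|c+d)⁻¹] = B(λ̄(a,b), λ̄(c,d)) · B(λ̄(c,d), λ̄(a,b)). -/
/-- the `Shuff(2,2)` identity.  With `λ̄` a symmetric 2-cocycle and
`μ` a 3-cochain whose coboundary is the `B`-cup product of `λ̄` with itself:
`[μ₁(b|c,d)·μ₁(a|c,d)·μ₁(a+b|c,d)⁻¹]·[μ₂(a,b|c)·μ₂(a,b|d)·μ₂(a,b|c+d)⁻¹]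
  = B(λ̄(a,b),λ̄(c,d))·B(λ̄(c,d),λ̄(a,b))`. -/
theorem statement10 {A M : Type*} [AddCommGroup A] [CommGroup M]
    (lam : A → A → M)
    (hsymm : ∀ a b : A, lam a b = lam b a)
    (hcoc : ∀ a b c : A, lam b c * lam a (b + c) = lam a b * lam (a + b) c)
    (B : M → M → ℂˣ) (μ : A → A → A → ℂˣ)
    (hμ : ∀ a b c d : A,
      μ b c d * μ a (b + c) d * μ a b c * (μ (a + b) c d)⁻¹ * (μ a b (c + d))⁻¹
        = B (lam a b) (lam c d)) :
    ∀ a b c d : A,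
      (mu1 μ b c d * mu1 μ a c d * (mu1 μ (a + b) c d)⁻¹) *
        (mu2 μ a b c * mu2 μ a b d * (mu2 μ a b (c + d))⁻¹)
      = B (lam a b) (lam c d) * B (lam c d) (lam a b) := by
  intro a b c d
  have hsplit : B (lam a b) (lam c d) * B (lam c d) (lam a b) =
      B (lam a b) (lam c d) * (B (lam a c) (lam b d))⁻¹ * B (lam a c) (lam d b) *
        B (lam c a) (lam b d) * (B (lam c a) (lam d b))⁻¹ * B (lam c d) (lam a b) := by
    rw [hsymm c a, hsymm d b]
    simp
  rw [hsplit]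
  simp only [← hμ, mu1, mu2]
  rw [add_comm c a, add_comm d b, add_comm c b, add_comm d a]
  apply Additive.ofMul.injective
  simp only [ofMul_mul, ofMul_inv]
  abel
end

section
/- For all a,b ∈ A, the function c ↦ O₂(a,b|c) is multiplicative in c: O₂(a,b|c+d) = O₂(a,b|c) · O₂(a,b|d) for all c,d ∈ A; that is, O₂(a,b|−) is a character of A with values in ℂˣ. -/
/-- The second obstruction cochain
`O₂(a,b|c) = ν(b,c)·ν(a,c)·ν(a+b,c)⁻¹·μ₂(a,b|c)`. -/
def obsTwo {A : Type*} [AddCommGroup A]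
    (μ : A → A → A → ℂˣ) (ν : A → A → ℂˣ) (a b c : A) : ℂˣ :=
  ν b c * ν a c * (ν (a + b) c)⁻¹ * mu2 μ a b c

/-- The `(2,2)`-shuffle of the coboundary of a 3-cochain, with coboundary values given by `F`,
expressed through the shuffles of the cochain. -/
theorem coboundary_shuffle_two_two {A G : Type*} [AddCommGroup A] [AddCommGroup G]
    (m : A → A → A → G) (F : A → A → A → A → G)
    (hm : ∀ a b c d : A,
      m b c d + m a (b + c) d + m a b c - m (a + b) c d - m a b (c + d) = F a b c d)
    (a b c d : A) :
    (m b c d - m c b d + m c d b) + (m a c d - m c a d + m c d a)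
      - (m (a + b) c d - m c (a + b) d + m c d (a + b))
      + (m a b c - m a c b + m c a b) + (m a b d - m a d b + m d a b)
      - (m a b (c + d) - m a (c + d) b + m (c + d) a b)
      = F a b c d - F a c b d + F a c d b + F c a b d - F c a d b + F c d a b := by
  simp only [← hm, add_comm c a, add_comm c b, add_comm d a, add_comm d b]
  abel

/-- With `λ̄` a symmetric 2-cocycle, `μ` a 3-cochain whose coboundary
is the `B`-cup product of `λ̄` with itself, `j̃` a family of homomorphisms compatible with
`λ̄` via `B`, and `ν` trivializing the first obstruction, the function `c ↦ O₂(a,b|c)` is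
multiplicative in `c` for all `a, b ∈ A`. -/
theorem statement11 {A M : Type*} [AddCommGroup A] [CommGroup M]
    (lam : A → A → M)
    (hsymm : ∀ a b : A, lam a b = lam b a)
    (hcoc : ∀ a b c : A, lam b c * lam a (b + c) = lam a b * lam (a + b) c)
    (B : M → M → ℂˣ) (μ : A → A → A → ℂˣ)
    (hμ : ∀ a b c d : A,
      μ b c d * μ a (b + c) d * μ a b c * (μ (a + b) c d)⁻¹ * (μ a b (c + d))⁻¹
        = B (lam a b) (lam c d))
    (jt : A → M →* ℂˣ)
    (hjt : ∀ (a b : A) (y : M),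
      jt a y * jt b y = jt (a + b) y * (B (lam a b) y)⁻¹ * (B y (lam a b))⁻¹)
    (ν : A → A → ℂˣ)
    (hν : ∀ a b c : A,
      ν a b * ν a c * (ν a (b + c))⁻¹ = mu1 μ a b c * jt a (lam b c)) :
    ∀ a b c d : A,
      obsTwo μ ν a b (c + d) = obsTwo μ ν a b c * obsTwo μ ν a b d := by
  intro a b c d
  have key := coboundary_shuffle_two_two (fun x y z => Additive.ofMul (μ x y z))
    (fun x y z w => Additive.ofMul (B (lam x y) (lam z w)))
    (fun x y z w => by
      simpa only [ofMul_mul, ofMul_inv, ← sub_eq_add_neg]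
        using congrArg Additive.ofMul (hμ x y z w)) a b c d
  have hj := congrArg Additive.ofMul (hjt a b (lam c d))
  have ha := congrArg Additive.ofMul (hν a c d)
  have hb := congrArg Additive.ofMul (hν b c d)
  have hab := congrArg Additive.ofMul (hν (a + b) c d)
  apply Additive.ofMul.injective
  simp only [hsymm c a, hsymm d b] at key
  simp only [obsTwo, mu1, mu2, ofMul_mul, ofMul_inv] at hj ha hb hab ⊢
  linear_combination (norm := abel) hab - ha - hb - hj - key
end

section
/- Let N be a positive integer, M an additive abelian group, and ν ∈ M. Define λ_ν : (ℤ/N)³ → M by λ_ν(i,j,k) = val(k)·ν if val(i) + val(j) ≥ N and λ_ν(i,j,k) = 0 otherwise. Then the coboundary of λ_ν is given by δλ_ν(i,j,k,l) := λ_ν(j,k,l) − λ_ν(i+j,k,l) + λ_ν(i,j+k,l) − λ_ν(i,j,k+l) + λ_ν(i,j,k) = N·ν if both val(i)+val(j) ≥ N and val(k)+val(l) ≥ N, and δλ_ν(i,j,k,l) = 0 otherwise. In particular, if N·ν = 0 then λ_ν is a 3-cocycle on ℤ/N with values in M. -/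
/-- The 3-cochain `λ_ν` on `ℤ/N`: `λ_ν(i,j,k) = val(k)·ν` if `val(i)+val(j) ≥ N`,
and `0` otherwise. -/
def lamCochain {M : Type*} [AddCommGroup M] (N : ℕ) (ν : M) (i j k : ZMod N) : M :=
  if N ≤ ZMod.val i + ZMod.val j then (ZMod.val k) • ν else 0

/-- The carry of the addition of `i` and `j` in `ℤ/N`, as an integer. -/
def zmodCarry (N : ℕ) (i j : ZMod N) : ℤ := if N ≤ i.val + j.val then 1 else 0

theorem val_add_add_mul_zmodCarry (N : ℕ) [NeZero N] (i j : ZMod N) :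
    ((i + j).val : ℤ) + N * zmodCarry N i j = i.val + j.val := by
  unfold zmodCarry
  split_ifs with h
  · have := ZMod.val_add_val_of_le h
    omega
  · have := ZMod.val_add_of_lt (not_le.mp h)
    omega

theorem zmodCarry_cocycle (N : ℕ) [NeZero N] (i j k : ZMod N) :
    zmodCarry N j k + zmodCarry N i (j + k) = zmodCarry N (i + j) k + zmodCarry N i j := by
  have hN : (N : ℤ) ≠ 0 := Nat.cast_ne_zero.mpr (NeZero.ne N)
  apply mul_left_cancel₀ hN
  have h₁ := val_add_add_mul_zmodCarry N j k
  have h₂ := val_add_add_mul_zmodCarry N i (j + k)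
  have h₃ := val_add_add_mul_zmodCarry N (i + j) k
  have h₄ := val_add_add_mul_zmodCarry N i j
  rw [add_assoc] at h₃
  linarith

theorem lamCochain_eq_zsmul {M : Type*} [AddCommGroup M] (N : ℕ) (ν : M) (i j k : ZMod N) :
    lamCochain N ν i j k = (zmodCarry N i j * k.val) • ν := by
  unfold lamCochain zmodCarry
  split_ifs <;> simp

theorem coboundary_lamCochain {M : Type*} [AddCommGroup M] (N : ℕ) [NeZero N] (ν : M)
    (i j k l : ZMod N) :
    lamCochain N ν j k l - lamCochain N ν (i + j) k l + lamCochain N ν i (j + k) l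
        - lamCochain N ν i j (k + l) + lamCochain N ν i j k
      = if N ≤ ZMod.val i + ZMod.val j ∧ N ≤ ZMod.val k + ZMod.val l
          then N • ν else 0 := by
  have h : (if N ≤ i.val + j.val ∧ N ≤ k.val + l.val then N • ν else 0)
      = (zmodCarry N i j * zmodCarry N k l * N) • ν := by
    by_cases h₁ : N ≤ i.val + j.val <;> by_cases h₂ : N ≤ k.val + l.val <;>
      simp [zmodCarry, h₁, h₂]
  rw [h]
  simp only [lamCochain_eq_zsmul, ← sub_smul, ← add_smul]
  congr 1
  linear_combination (l.val : ℤ) * zmodCarry_cocycle N i j k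
    - zmodCarry N i j * val_add_add_mul_zmodCarry N k l

/-- Let `N > 0`, `M` an additive abelian group, `ν ∈ M`.  The
coboundary of the 3-cochain `λ_ν` is `N·ν` when both `val(i)+val(j) ≥ N` and
`val(k)+val(l) ≥ N`, and `0` otherwise.  In particular, if `N·ν = 0` then `λ_ν` is a
3-cocycle on `ℤ/N` with values in `M`. -/
theorem statement14 {M : Type*} [AddCommGroup M] (N : ℕ) (hN : 0 < N) (ν : M) :
    (∀ i j k l : ZMod N,
      lamCochain N ν j k l - lamCochain N ν (i + j) k l + lamCochain N ν i (j + k) l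
          - lamCochain N ν i j (k + l) + lamCochain N ν i j k
        = if N ≤ ZMod.val i + ZMod.val j ∧ N ≤ ZMod.val k + ZMod.val l
            then N • ν else 0) ∧
    (N • ν = 0 → ∀ i j k l : ZMod N,
      lamCochain N ν j k l - lamCochain N ν (i + j) k l + lamCochain N ν i (j + k) l
          - lamCochain N ν i j (k + l) + lamCochain N ν i j k = 0) := by
  have : NeZero N := ⟨hN.ne'⟩
  refine ⟨coboundary_lamCochain N ν, fun h i j k l => ?_⟩
  rw [coboundary_lamCochain, h, ite_self]
end

section
/- Let N be a positive integer and s a nonzero complex number (equivalently an element of ℂˣ). Define t : ℤ/N × ℤ/N → ℂˣ by t(i,j) = s^{−val(i)·val(j)}. Then t is symmetric, and for all i,j,k ∈ ℤ/N: t(i,k)·t(j,k) = t(i+j,k)·(s^N)^{−val(k)} if val(i)+val(j) ≥ N, and t(i,k)·t(j,k) = t(i+j,k) if val(i)+val(j) < N. (This is the computation showing that, when s^N = ζ^{−(ε+2b)}, the isomorphisms t_s(i,j) = s^{−ij}·id_{λ_a(i,j)} satisfy the braided zesting condition relative to the 3-cochain λ_b of the cyclic associative zesting.) -/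
/-- Let `N > 0` and `s ∈ ℂˣ`.  Define `t(i,j) = s^{−val(i)·val(j)}` on
`ℤ/N × ℤ/N`.  Then `t` is symmetric, and
`t(i,k)·t(j,k) = t(i+j,k)·(s^N)^{−val(k)}` when `val(i)+val(j) ≥ N`, while
`t(i,k)·t(j,k) = t(i+j,k)` when `val(i)+val(j) < N`. -/
theorem statement15 (N : ℕ) (hN : 0 < N) (s : ℂˣ) :
    (∀ i j : ZMod N,
      s ^ (-((ZMod.val i : ℤ) * (ZMod.val j : ℤ)))
        = s ^ (-((ZMod.val j : ℤ) * (ZMod.val i : ℤ)))) ∧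
    (∀ i j k : ZMod N, N ≤ ZMod.val i + ZMod.val j →
      s ^ (-((ZMod.val i : ℤ) * (ZMod.val k : ℤ))) *
          s ^ (-((ZMod.val j : ℤ) * (ZMod.val k : ℤ)))
        = s ^ (-((ZMod.val (i + j) : ℤ) * (ZMod.val k : ℤ))) *
            (s ^ (N : ℤ)) ^ (-(ZMod.val k : ℤ))) ∧
    (∀ i j k : ZMod N, ZMod.val i + ZMod.val j < N →
      s ^ (-((ZMod.val i : ℤ) * (ZMod.val k : ℤ))) *
          s ^ (-((ZMod.val j : ℤ) * (ZMod.val k : ℤ)))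
        = s ^ (-((ZMod.val (i + j) : ℤ) * (ZMod.val k : ℤ)))) := by
  have : NeZero N := ⟨hN.ne'⟩
  refine ⟨fun i j => by rw [mul_comm], fun i j k h => ?_, fun i j k h => ?_⟩
  · have hv : (ZMod.val i : ℤ) + ZMod.val j = ZMod.val (i + j) + N := by
      exact_mod_cast (ZMod.val_add_val_of_le h)
    rw [← zpow_add, ← zpow_mul, ← zpow_add]
    congr 1
    linear_combination (-(ZMod.val k : ℤ)) * hv
  · rw [← zpow_add, ZMod.val_add_of_lt h]
    congr 1
    push_cast
    ring
end
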